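/- Let m ≥ 2 and let c₂, …, c_m be rational numbers such that n^m = Σ_{k=2}^{m} c_k·ψ_k(n) for every natural number n ≥ 1. Then the highest-order coefficient satisfies c_m = (m−2)!. -/

import Mathlib

/-- `binom a b = (a+b)!/(a!·b!) = C(a+b, a)`. -/
def binom (a b : ℕ) : ℕ := Nat.choose (a + b) a

/-- `psi m n = n + (m−1)·(n−1)·B_{m−1,n−1}`. -/
def psi (m n : ℕ) : ℕ := n + (m - 1) * (n - 1) * binom (m - 1) (n - 1)

open Polynomial in
/-- The polynomial in `n` interpolating `psi (j + 2) n` on the positive integers. -/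
noncomputable def psiPoly (j : ℕ) : ℚ[X] :=
  X + C ((j.factorial : ℚ)⁻¹) * ((X - 1) * ascPochhammer ℚ (j + 1))

open Polynomial in
theorem psiPoly_eval (j n : ℕ) (hn : 1 ≤ n) :
    (psiPoly j).eval (n : ℚ) = psi (j + 2) n := by
  obtain ⟨t, rfl⟩ := Nat.exists_eq_add_of_le' hn
  have h := Nat.ascFactorial_eq_factorial_mul_choose t (j + 1)
  have hj : (j.factorial : ℚ) ≠ 0 := by positivity
  rw [psiPoly, psi, binom, eval_add, eval_X, eval_mul, eval_C, eval_mul,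
    ← ascPochhammer_eval_cast, ascPochhammer_nat_eq_ascFactorial, h, Nat.factorial_succ,
    show j + 2 - 1 = j + 1 by omega, show t + 1 - 1 = t by omega, add_comm (j + 1) t]
  simp only [eval_sub, eval_X, eval_one]
  push_cast
  field_simp
  ring

open Polynomial in
theorem natDegree_X_sub_one_mul_ascPochhammer (k : ℕ) :
    ((X - 1) * ascPochhammer ℚ k).natDegree = k + 1 := by
  rw [show (X - 1 : ℚ[X]) = X - C 1 by simp,
    (monic_X_sub_C 1).natDegree_mul (monic_ascPochhammer ℚ k),
    natDegree_X_sub_C, ascPochhammer_natDegree, add_comm]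

open Polynomial in
theorem psiPoly_coeff_self (j : ℕ) :
    (psiPoly j).coeff (j + 2) = (j.factorial : ℚ)⁻¹ := by
  have hmonic : ((X - 1) * ascPochhammer ℚ (j + 1)).Monic := by
    rw [show (X - 1 : ℚ[X]) = X - C 1 by simp]
    exact (monic_X_sub_C 1).mul (monic_ascPochhammer ℚ _)
  have h := hmonic.coeff_natDegree
  rw [natDegree_X_sub_one_mul_ascPochhammer] at h
  rw [psiPoly, coeff_add, coeff_C_mul, h, coeff_X_of_ne_one (by omega), zero_add, mul_one]

open Polynomial in
theorem psiPoly_coeff_of_lt (j i : ℕ) (h : j + 2 < i) : (psiPoly j).coeff i = 0 := by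
  rw [psiPoly, coeff_add, coeff_C_mul, coeff_X_of_ne_one (by omega),
    coeff_eq_zero_of_natDegree_lt (p := (X - 1) * _), mul_zero, add_zero]
  rwa [natDegree_X_sub_one_mul_ascPochhammer]

open Polynomial in
theorem X_pow_eq_sum_psiPoly (m : ℕ) (c : ℕ → ℚ)
    (hc : ∀ n : ℕ, 1 ≤ n → (n : ℚ) ^ m = ∑ k ∈ Finset.Icc 2 m, c k * psi k n) :
    (X ^ m : ℚ[X]) = ∑ k ∈ Finset.Icc 2 m, C (c k) * psiPoly (k - 2) := by
  refine eq_of_infinite_eval_eq _ _ (((Set.Ici_infinite 1).image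
    (Nat.cast_injective (R := ℚ)).injOn).mono ?_)
  rintro _ ⟨n, hn, rfl⟩
  simp only [Set.mem_ofPred_eq, eval_pow, eval_X, eval_finsetSum, eval_mul, eval_C, hc n hn]
  refine Finset.sum_congr rfl fun k hk => ?_
  rw [psiPoly_eval _ _ hn, Nat.sub_add_cancel (Finset.mem_Icc.mp hk).1]

theorem leading_coefficient_eq_factorial (m : ℕ) (hm : 2 ≤ m) (c : ℕ → ℚ)
    (hc : ∀ n : ℕ, 1 ≤ n → (n : ℚ) ^ m = ∑ k ∈ Finset.Icc 2 m, c k * psi k n) :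
    c m = Nat.factorial (m - 2) := by
  have h := congrArg (Polynomial.coeff · m) (X_pow_eq_sum_psiPoly m c hc)
  simp only [Polynomial.coeff_X_pow_self, Polynomial.finsetSum_coeff,
    Polynomial.coeff_C_mul] at h
  have hself := psiPoly_coeff_self (m - 2)
  rw [Nat.sub_add_cancel hm] at hself
  rw [Finset.sum_eq_single_of_mem m (Finset.mem_Icc.mpr ⟨hm, le_rfl⟩), hself] at h
  · have : ((m - 2).factorial : ℚ) ≠ 0 := by positivity
    field_simp at h
    exact h.symm
  · intro k hk hne
    rw [Finset.mem_Icc] at hk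
    rw [psiPoly_coeff_of_lt _ _ (by omega), mul_zero]
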